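/- Let (G,·,0) be a BCI-algebra whose A-holomorph (H,∘,(id,0)) is also a BCI-algebra. Then (H,∘,(id,0)) is p-semisimple if and only if (G,·,0) is p-semisimple. -/

import Mathlib

def IsBCI {G : Type*} (op : G → G → G) (e : G) : Prop :=
  (∀ x y z, op (op (op x y) (op x z)) (op z y) = e) ∧
  (∀ x, op x e = x) ∧
  (∀ x y, op x y = e → op y x = e → x = y)

def IsPSemisimple {G : Type*} (op : G → G → G) (e : G) : Prop :=
  ∀ x, op e (op e x) = x

/-- The operation of the `A`-holomorph of `(G, op)`:
`(α,x)∘(β,y) = (αβ, β(x)·y)`. -/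
def holOp {G : Type*} (op : G → G → G) (A : Subgroup (Equiv.Perm G)) :
    A × G → A × G → A × G :=
  fun p q => (p.1 * q.1, op ((q.1 : Equiv.Perm G) p.2) q.2)

theorem IsBCI.op_self {G : Type*} {op : G → G → G} {e : G} (h : IsBCI op e) (x : G) :
    op x x = e := by
  simpa only [h.2.1] using h.1 x e e

theorem IsBCI.map_zero {G : Type*} {op : G → G → G} {e : G} (h : IsBCI op e) {f : G → G}
    (hf : ∀ x y, f (op x y) = op (f x) (f y)) : f e = e := by
  simpa only [h.op_self] using hf e e

theorem holomorph_pSemisimple_iff {G : Type*} (op : G → G → G) (e : G)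
    (A : Subgroup (Equiv.Perm G))
    (hAut : ∀ φ : Equiv.Perm G, φ ∈ A → ∀ x y : G, φ (op x y) = op (φ x) (φ y))
    (hBool : ∀ φ : Equiv.Perm G, φ ∈ A → φ * φ = 1)
    (hG : IsBCI op e) (hH : IsBCI (holOp op A) ((1 : A), e)) :
    IsPSemisimple (holOp op A) ((1 : A), e) ↔ IsPSemisimple op e := by
  have key (p : A × G) : holOp op A (1, e) p = (p.1, op e p.2) := by
    simp only [holOp, one_mul, hG.map_zero (hAut _ p.1.2)]
  constructor
  · intro h x
    have hx := h (1, x)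
    rw [key, key] at hx
    exact congrArg Prod.snd hx
  · intro h p
    rw [key, key, h]
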